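/- arXiv:2004.12325 — 3 statements merged into one kernel-verified Lean document; each statement's English description precedes it below -/
import Mathlib

section
/- Let X be a pointed metric space with base point 0 and H a real Hilbert space. If T : X → H is a Lipschitz map with T(0) = 0 such that the restriction of its Lipschitz adjoint to H*, namely the linear map H* → X^# sending ψ to ψ ∘ T, is absolutely q-summing for some 1 ≤ q < ∞, then T is Lipschitz 1-summing. -/
open scoped BigOperators NNReal

/-- The weak `ℓ_p` norm of a finite family in a normed space. -/
noncomputable def weakNorm (p : ℝ) {E : Type*} [NormedAddCommGroup E] [NormedSpace ℝ E]
    {n : ℕ} (x : Fin n → E) : ℝ :=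
  ⨆ φ : {φ : E →L[ℝ] ℝ // ‖φ‖ ≤ 1}, (∑ i, |φ.1 (x i)| ^ p) ^ (1 / p)

/-- The Lipschitz norm of `g : X → ℝ`, i.e. the norm in `X^#`:
the least `K ≥ 0` with `|g x − g y| ≤ K d(x,y)`. -/
noncomputable def lipNorm {X : Type*} [MetricSpace X] (g : X → ℝ) : ℝ :=
  sInf {K : ℝ | 0 ≤ K ∧ ∀ x y : X, |g x - g y| ≤ K * dist x y}

/-- A linear map `u : E → X^#` (recorded as a map into functions `X → ℝ`, measured with the
Lipschitz norm) is absolutely `q`-summing: there is `C ≥ 0` with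
`(∑ Lip(u(hᵢ))^q)^{1/q} ≤ C ‖(hᵢ)‖_{q,w}` for all finite families `hᵢ ∈ E`. -/
def AbsSummingIntoLip (q : ℝ) {E X : Type*} [NormedAddCommGroup E] [NormedSpace ℝ E]
    [MetricSpace X] (u : E → X → ℝ) : Prop :=
  ∃ C : ℝ, 0 ≤ C ∧ ∀ (n : ℕ) (h : Fin n → E),
    (∑ i, lipNorm (u (h i)) ^ q) ^ (1 / q) ≤ C * weakNorm q h

/-- `T : X → Y` is Lipschitz `p`-summing (base point `base`): there is `C ≥ 0` with
`(∑ ‖T(xᵢ) − T(qᵢ)‖^p)^{1/p} ≤ C sup_{φ ∈ B_{X^#}} (∑ |φ(xᵢ) − φ(qᵢ)|^p)^{1/p}`. -/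
def LipschitzSumming (p : ℝ) {X Y : Type*} [MetricSpace X] [NormedAddCommGroup Y]
    (base : X) (T : X → Y) : Prop :=
  ∃ C : ℝ, 0 ≤ C ∧ ∀ (n : ℕ) (x q : Fin n → X),
    (∑ i, ‖T (x i) - T (q i)‖ ^ p) ^ (1 / p) ≤
      C * ⨆ φ : {φ : X → ℝ // LipschitzWith 1 φ ∧ φ base = 0},
        (∑ i, |φ.1 (x i) - φ.1 (q i)| ^ p) ^ (1 / p)

/-- The Rademacher sum `∑ j, ±a j` with signs prescribed by `ε`. -/
noncomputable def rademacherSum {n : ℕ} (a : Fin n → ℝ) (ε : Fin n → Bool) : ℝ :=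
  ∑ j, (if ε j then 1 else -1 : ℝ) * a j

theorem sum_signs_succ {n : ℕ} (F : (Fin (n + 1) → Bool) → ℝ) :
    ∑ ε, F ε = ∑ ε : Fin n → Bool, (F (Fin.cons true ε) + F (Fin.cons false ε)) := by
  rw [← Fintype.sum_equiv (Fin.consEquiv fun _ => Bool) (fun p => F (Fin.cons p.1 p.2)) F
    (fun _ => rfl), Fintype.sum_prod_type]
  simp [Finset.sum_add_distrib]

theorem rademacherSum_cons {n : ℕ} (a : Fin (n + 1) → ℝ) (b : Bool) (ε : Fin n → Bool) :
    rademacherSum a (Fin.cons b ε) =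
      (if b then 1 else -1 : ℝ) * a 0 + rademacherSum (fun j => a j.succ) ε := by
  simp [rademacherSum, Fin.sum_univ_succ]

theorem sum_rademacherSum_sq {n : ℕ} (a : Fin n → ℝ) :
    ∑ ε, rademacherSum a ε ^ 2 = 2 ^ n * ∑ j, a j ^ 2 := by
  induction n with
  | zero => simp [rademacherSum]
  | succ n ih =>
    have h : ∀ ε : Fin n → Bool, rademacherSum a (Fin.cons true ε) ^ 2 +
        rademacherSum a (Fin.cons false ε) ^ 2 =
        2 * a 0 ^ 2 + 2 * rademacherSum (fun j => a j.succ) ε ^ 2 := fun ε => by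
      simp only [rademacherSum_cons, if_true, Bool.false_eq_true, if_false]
      ring
    rw [sum_signs_succ, Finset.sum_congr rfl fun ε _ => h ε, Finset.sum_add_distrib,
      ← Finset.mul_sum, ← Finset.mul_sum, ih, Fin.sum_univ_succ]
    simp
    ring

theorem sum_rademacherSum_pow_four_le {n : ℕ} (a : Fin n → ℝ) :
    ∑ ε, rademacherSum a ε ^ 4 ≤ 3 * 2 ^ n * (∑ j, a j ^ 2) ^ 2 := by
  induction n with
  | zero => simp [rademacherSum]
  | succ n ih =>
    have h : ∀ ε : Fin n → Bool, rademacherSum a (Fin.cons true ε) ^ 4 +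
        rademacherSum a (Fin.cons false ε) ^ 4 =
        2 * a 0 ^ 4 + (12 * a 0 ^ 2) * rademacherSum (fun j => a j.succ) ε ^ 2 +
          2 * rademacherSum (fun j => a j.succ) ε ^ 4 := fun ε => by
      simp only [rademacherSum_cons, if_true, Bool.false_eq_true, if_false]
      ring
    rw [sum_signs_succ, Finset.sum_congr rfl fun ε _ => h ε, Finset.sum_add_distrib,
      Finset.sum_add_distrib, ← Finset.mul_sum, ← Finset.mul_sum, ← Finset.mul_sum, sum_rademacherSum_sq,
      Fin.sum_univ_succ]
    have h4 := ih fun j => a j.succ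
    have h0 : 0 ≤ (2 : ℝ) ^ n * a 0 ^ 4 := by positivity
    simp only [Finset.sum_const, Finset.card_univ, Fintype.card_pi, Fintype.card_bool,
      Finset.prod_const, Fintype.card_fin, nsmul_eq_mul, Nat.cast_pow, Nat.cast_ofNat]
    rw [pow_succ 2 n]
    linarith

theorem sum_exp_rademacherSum_le {n : ℕ} (a : Fin n → ℝ) :
    ∑ ε, Real.exp (rademacherSum a ε) ≤ 2 ^ n * Real.exp ((∑ j, a j ^ 2) / 2) := by
  induction n with
  | zero => simp [rademacherSum]
  | succ n ih =>
    have h : ∀ ε : Fin n → Bool, Real.exp (rademacherSum a (Fin.cons true ε)) +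
        Real.exp (rademacherSum a (Fin.cons false ε)) =
        2 * Real.cosh (a 0) * Real.exp (rademacherSum (fun j => a j.succ) ε) := fun ε => by
      simp only [rademacherSum_cons, if_true, Bool.false_eq_true, if_false, Real.exp_add,
        Real.cosh_eq, one_mul, neg_one_mul]
      ring
    rw [sum_signs_succ, Finset.sum_congr rfl fun ε _ => h ε, ← Finset.mul_sum,
      Fin.sum_univ_succ, add_div, Real.exp_add]
    calc _ ≤ 2 * Real.exp (a 0 ^ 2 / 2) *
          (2 ^ n * Real.exp ((∑ j : Fin n, a j.succ ^ 2) / 2)) := by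
          gcongr
          · exact Real.cosh_le_exp_half_sq _
          · exact ih _
      _ = _ := by ring

theorem rademacherSum_const_mul {n : ℕ} (c : ℝ) (a : Fin n → ℝ) (ε : Fin n → Bool) :
    rademacherSum (fun j => c * a j) ε = c * rademacherSum a ε := by
  simp only [rademacherSum, Finset.mul_sum]
  exact Finset.sum_congr rfl fun _ _ => by ring

/-- The upper Khintchine inequality for coefficients in the unit ball of `ℓ₂`. -/
theorem sum_abs_rademacherSum_rpow_le {n : ℕ} {q : ℝ} (hq : 0 ≤ q) (a : Fin n → ℝ)
    (ha : ∑ j, a j ^ 2 ≤ 1) :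
    ∑ ε, |rademacherSum a ε| ^ q ≤ 2 ^ n * (2 * Real.exp (q ^ 2 / 2)) := by
  have hexp : ∀ x : ℝ, |x| ^ q ≤ Real.exp (q * x) + Real.exp (-q * x) := fun x => by
    calc |x| ^ q ≤ Real.exp |x| ^ q := by
          gcongr
          linarith [Real.add_one_le_exp |x|]
      _ = Real.exp (q * |x|) := by rw [← Real.exp_mul, mul_comm]
      _ ≤ _ := by
          rcases abs_choice x with h | h <;> rw [h]
          · linarith [Real.exp_pos (-q * x)]
          · rw [mul_neg, ← neg_mul]
            linarith [Real.exp_pos (q * x)]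
  have hmgf : ∀ c : ℝ, c ^ 2 = q ^ 2 →
      ∑ ε, Real.exp (c * rademacherSum a ε) ≤ 2 ^ n * Real.exp (q ^ 2 / 2) := fun c hc => by
    have h := sum_exp_rademacherSum_le fun j => c * a j
    simp only [rademacherSum_const_mul, mul_pow, ← Finset.mul_sum, hc] at h
    refine h.trans ?_
    gcongr
    nlinarith [sq_nonneg q]
  calc _ ≤ ∑ ε, (Real.exp (q * rademacherSum a ε) + Real.exp (-q * rademacherSum a ε)) :=
        Finset.sum_le_sum fun ε _ => hexp _
    _ ≤ _ := by
        rw [Finset.sum_add_distrib]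
        linarith [hmgf q rfl, hmgf (-q) (neg_sq q)]

/-- The lower Khintchine inequality in `L₁`. -/
theorem le_sum_abs_rademacherSum {n : ℕ} (a : Fin n → ℝ) {r : ℝ} (hr : 0 ≤ r)
    (ha : ∑ j, a j ^ 2 = r ^ 2) :
    2 ^ n * r ≤ 8 * ∑ ε, |rademacherSum a ε| := by
  rcases hr.eq_or_lt with rfl | hr
  · simp only [mul_zero]
    positivity
  have key : ∀ x : ℝ, 4 * r ^ 2 * x ^ 2 ≤ 8 * r ^ 3 * |x| + x ^ 4 := fun x => by
    have hx := abs_nonneg x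
    have h4 : x ^ 4 = |x| * |x| ^ 3 := by rw [← pow_succ', (by decide : Even 4).pow_abs]
    rw [← sq_abs x, h4]
    have : 4 * r ^ 2 * |x| ≤ 8 * r ^ 3 + |x| ^ 3 := by
      rcases le_total |x| (2 * r) with h | h
      · have := mul_le_mul_of_nonneg_left h (by positivity : 0 ≤ 4 * r ^ 2)
        have := pow_nonneg hx 3
        linarith
      · have := pow_le_pow_left₀ (by positivity) h 2
        have := mul_le_mul_of_nonneg_right this hx
        have := pow_pos hr 3
        linarith
    linarith [mul_le_mul_of_nonneg_left this hx]
  have hsum := Finset.sum_le_sum fun ε (_ : ε ∈ Finset.univ) => key (rademacherSum a ε)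
  rw [Finset.sum_add_distrib, ← Finset.mul_sum, ← Finset.mul_sum, sum_rademacherSum_sq, ha] at hsum
  have h4 := sum_rademacherSum_pow_four_le a
  rw [ha] at h4
  refine le_of_mul_le_mul_left ?_ (pow_pos hr 3)
  linarith

/-- The Lipschitz norm is a Lipschitz constant. -/
theorem abs_sub_le_lipNorm_mul {X : Type*} [MetricSpace X] {g : X → ℝ} {K : ℝ≥0}
    (hg : LipschitzWith K g) (x y : X) : |g x - g y| ≤ lipNorm g * dist x y := by
  rcases eq_or_ne x y with rfl | hxy
  · simp
  have hd := dist_pos.2 hxy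
  rw [← div_le_iff₀ hd]
  refine le_csInf ⟨K, K.2, fun x y => hg.dist_le_mul x y⟩ ?_
  rintro L ⟨-, hL⟩
  exact (div_le_iff₀ hd).2 (hL x y)

theorem lipNorm_nonneg {X : Type*} [MetricSpace X] (g : X → ℝ) : 0 ≤ lipNorm g :=
  Real.sInf_nonneg fun _ h => h.1

/-- A Lipschitz function tests the strong side of the Lipschitz `1`-summing inequality. -/
theorem sum_abs_sub_le_lipNorm_mul_iSup {X : Type*} [MetricSpace X] {base : X} {g : X → ℝ}
    {K : ℝ≥0} (hg : LipschitzWith K g) (hg0 : g base = 0) {n : ℕ} (x y : Fin n → X) :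
    ∑ i, |g (x i) - g (y i)| ≤ (lipNorm g + 1) *
      ⨆ φ : {φ : X → ℝ // LipschitzWith 1 φ ∧ φ base = 0}, ∑ i, |φ.1 (x i) - φ.1 (y i)| := by
  have hL : 0 < lipNorm g + 1 := by linarith [lipNorm_nonneg g]
  have hbdd : BddAbove (Set.range fun φ : {φ : X → ℝ // LipschitzWith 1 φ ∧ φ base = 0} =>
      ∑ i, |φ.1 (x i) - φ.1 (y i)|) := by
    refine ⟨∑ i, dist (x i) (y i), ?_⟩
    rintro _ ⟨φ, rfl⟩
    refine Finset.sum_le_sum fun i _ => ?_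
    simpa [Real.dist_eq] using φ.2.1.dist_le_mul (x i) (y i)
  have hφ : LipschitzWith 1 fun z => g z / (lipNorm g + 1) := by
    refine LipschitzWith.of_dist_le_mul fun z w => ?_
    rw [Real.dist_eq, ← sub_div, abs_div, abs_of_pos hL, div_le_iff₀ hL, NNReal.coe_one, one_mul]
    linarith [abs_sub_le_lipNorm_mul hg z w, dist_nonneg (x := z) (y := w)]
  have h := le_ciSup hbdd ⟨fun z => g z / (lipNorm g + 1), hφ, by simp [hg0]⟩
  simp only [← sub_div, abs_div, abs_of_pos hL] at h
  rwa [← Finset.sum_div, div_le_iff₀ hL, mul_comm] at h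

/-- Functionals of norm at most one satisfy Bessel's inequality on an orthonormal family of
inner-product functionals. -/
theorem sum_sq_apply_innerSL_le_one {H : Type*} [NormedAddCommGroup H] [InnerProductSpace ℝ H]
    {d : ℕ} {e : Fin d → H} (he : Orthonormal ℝ e) {φ : (H →L[ℝ] ℝ) →L[ℝ] ℝ} (hφ : ‖φ‖ ≤ 1) :
    ∑ j, φ (innerSL ℝ (e j)) ^ 2 ≤ 1 := by
  set a : Fin d → ℝ := fun j => φ (innerSL ℝ (e j)) with ha
  have h1 : φ (innerSL ℝ (∑ j, a j • e j)) = ∑ j, a j ^ 2 := by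
    simp [map_sum, ha, sq]
  have h2 : ‖∑ j, a j • e j‖ ^ 2 = ∑ j, a j ^ 2 := by
    rw [← real_inner_self_eq_norm_sq, he.inner_sum]
    simp [sq]
  have h3 : φ (innerSL ℝ (∑ j, a j • e j)) ≤ ‖∑ j, a j • e j‖ := by
    refine (Real.le_norm_self _).trans ((φ.le_of_opNorm_le hφ _).trans ?_)
    rw [innerSL_apply_norm, one_mul]
  rw [h1, ← h2] at h3
  change ∑ j, a j ^ 2 ≤ 1
  rw [← h2]
  have := norm_nonneg (∑ j, a j • e j)
  nlinarith

/-- Absolutely summing maps have bounded average Lipschitz norm on Rademacher sums of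
orthonormal families. -/
theorem sum_lipNorm_le_of_absSumming {X H : Type*} [MetricSpace X] [NormedAddCommGroup H]
    [InnerProductSpace ℝ H] {u : (H →L[ℝ] ℝ) → X → ℝ} {q C : ℝ} (hq : 1 ≤ q) (hC : 0 ≤ C)
    (hu : ∀ (n : ℕ) (h : Fin n → H →L[ℝ] ℝ),
      (∑ i, lipNorm (u (h i)) ^ q) ^ (1 / q) ≤ C * weakNorm q h)
    {d : ℕ} {e : Fin d → H} (he : Orthonormal ℝ e) :
    ∑ ε : Fin d → Bool, lipNorm (u (innerSL ℝ (∑ j, (if ε j then 1 else -1 : ℝ) • e j))) ≤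
      2 ^ d * (1 + C ^ q * (2 * Real.exp (q ^ 2 / 2))) := by
  have hq0 : 0 < q := by linarith
  set h : (Fin d → Bool) → H →L[ℝ] ℝ :=
    fun ε => innerSL ℝ (∑ j, (if ε j then 1 else -1 : ℝ) • e j) with hh
  set B : ℝ := 2 ^ d * (2 * Real.exp (q ^ 2 / 2)) with hB
  have hB0 : 0 ≤ B := by positivity
  let σ := (Fintype.equivFin (Fin d → Bool)).symm
  have hweak : weakNorm q (fun k => h (σ k)) ≤ B ^ (1 / q) := by
    refine Real.iSup_le (fun φ => ?_) (by positivity)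
    refine Real.rpow_le_rpow (by positivity) ?_ (by positivity)
    rw [Equiv.sum_comp σ fun ε => |φ.1 (h ε)| ^ q]
    refine le_trans (le_of_eq ?_) (sum_abs_rademacherSum_rpow_le hq0.le
      (fun j => φ.1 (innerSL ℝ (e j))) (sum_sq_apply_innerSL_le_one he φ.2))
    refine Finset.sum_congr rfl fun ε _ => ?_
    simp only [hh, rademacherSum, map_sum, map_smul, smul_eq_mul]
  have hsum := (hu _ fun k => h (σ k)).trans (mul_le_mul_of_nonneg_left hweak hC)
  rw [Equiv.sum_comp σ fun ε => lipNorm (u (h ε)) ^ q] at hsum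
  have hnn : 0 ≤ ∑ ε, lipNorm (u (h ε)) ^ q :=
    Finset.sum_nonneg fun ε _ => Real.rpow_nonneg (lipNorm_nonneg _) _
  have hpow := Real.rpow_le_rpow (by positivity) hsum hq0.le
  rw [Real.mul_rpow hC (by positivity), ← Real.rpow_mul hnn, ← Real.rpow_mul hB0,
    one_div_mul_cancel hq0.ne', Real.rpow_one, Real.rpow_one] at hpow
  have hone : ∀ t : ℝ, 0 ≤ t → t ≤ 1 + t ^ q := fun t ht => by
    rcases le_total t 1 with h1 | h1
    · linarith [Real.rpow_nonneg ht q]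
    · linarith [Real.self_le_rpow_of_one_le h1 hq]
  calc _ ≤ ∑ ε, (1 + lipNorm (u (h ε)) ^ q) :=
        Finset.sum_le_sum fun ε _ => hone _ (lipNorm_nonneg _)
    _ = 2 ^ d + ∑ ε, lipNorm (u (h ε)) ^ q := by simp [Finset.sum_add_distrib]
    _ ≤ 2 ^ d + C ^ q * B := by linarith
    _ = _ := by rw [hB]; ring

/-- The lower Khintchine inequality for vectors satisfying Parseval's identity. -/
theorem norm_le_sum_abs_innerSL {H : Type*} [NormedAddCommGroup H] [InnerProductSpace ℝ H]
    {d : ℕ} {e : Fin d → H} {w : H} (hw : ∑ j, (inner ℝ (e j) w) ^ 2 = ‖w‖ ^ 2) :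
    2 ^ d * ‖w‖ ≤
      8 * ∑ ε : Fin d → Bool, |innerSL ℝ (∑ j, (if ε j then 1 else -1 : ℝ) • e j) w| := by
  refine (le_sum_abs_rademacherSum _ (norm_nonneg w) hw).trans_eq ?_
  simp only [rademacherSum, map_sum, map_smul, sum_apply, smul_apply, innerSL_apply_apply,
    smul_eq_mul]

/-- Every finite family admits an orthonormal family satisfying Parseval's identity on it. -/
theorem exists_orthonormal_sum_inner_sq {H : Type*} [NormedAddCommGroup H]
    [InnerProductSpace ℝ H] {n : ℕ} (v : Fin n → H) :
    ∃ (d : ℕ) (e : Fin d → H), Orthonormal ℝ e ∧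
      ∀ i, ∑ j, (inner ℝ (e j) (v i)) ^ 2 = ‖v i‖ ^ 2 := by
  let V := Submodule.span ℝ (Set.range v)
  have : FiniteDimensional ℝ V := FiniteDimensional.span_of_finite ℝ (Set.finite_range v)
  let b := stdOrthonormalBasis ℝ V
  refine ⟨_, fun j => b j, b.orthonormal.comp_linearIsometry V.subtypeₗᵢ, fun i => ?_⟩
  have hv : v i ∈ V := Submodule.subset_span ⟨i, rfl⟩
  simpa using b.sum_sq_norm_inner_right ⟨v i, hv⟩

/-- **Chen–Zheng theorem.** Let `X` be a pointed metric space (base point `base`) and `H` a real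
Hilbert space. If `T : X → H` is Lipschitz with `T base = 0` and the restriction of its
Lipschitz adjoint to `H*`, `ψ ↦ ψ ∘ T : H* → X^#`, is absolutely `q`-summing for some
`1 ≤ q < ∞`, then `T` is Lipschitz `1`-summing. -/
theorem chen_zheng {X H : Type*} [MetricSpace X] (base : X)
    [NormedAddCommGroup H] [InnerProductSpace ℝ H] [CompleteSpace H]
    (T : X → H) (hT : ∃ K : ℝ≥0, LipschitzWith K T) (hT0 : T base = 0)
    (hadj : ∃ q : ℝ, 1 ≤ q ∧
      AbsSummingIntoLip q (fun ψ : H →L[ℝ] ℝ => fun x => ψ (T x))) :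
    LipschitzSumming 1 base T := by
  obtain ⟨K, hK⟩ := hT
  obtain ⟨q, hq, C, hC, hu⟩ := hadj
  obtain ⟨M, hM⟩ : ∃ M : ℝ, M = 1 + C ^ q * (2 * Real.exp (q ^ 2 / 2)) := ⟨_, rfl⟩
  have hM0 : 0 ≤ M := by rw [hM]; positivity
  refine ⟨8 * (M + 1), by positivity, fun n x y => ?_⟩
  simp only [Real.rpow_one, div_one]
  set S := ⨆ φ : {φ : X → ℝ // LipschitzWith 1 φ ∧ φ base = 0},
    ∑ i, |φ.1 (x i) - φ.1 (y i)|
  have hS0 : 0 ≤ S := Real.iSup_nonneg fun φ => by positivity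
  let v : Fin n → H := fun i => T (x i) - T (y i)
  obtain ⟨d, e, he, hnorm⟩ := exists_orthonormal_sum_inner_sq v
  obtain ⟨h, hh⟩ : ∃ h : (Fin d → Bool) → H →L[ℝ] ℝ,
    h = fun ε => innerSL ℝ (∑ j, (if ε j then 1 else -1 : ℝ) • e j) := ⟨_, rfl⟩
  have hlower : ∀ i, 2 ^ d * ‖v i‖ ≤ 8 * ∑ ε, |h ε (v i)| := fun i => by
    rw [hh]
    exact norm_le_sum_abs_innerSL (hnorm i)
  have hupper : ∀ ε, ∑ i, |h ε (v i)| ≤ (lipNorm (fun z => h ε (T z)) + 1) * S := fun ε => by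
    simp only [v, map_sub]
    exact sum_abs_sub_le_lipNorm_mul_iSup (base := base) (g := fun z => h ε (T z))
      ((h ε).lipschitz.comp hK) (by simp [hT0]) x y
  have hlip : ∑ ε, lipNorm (fun z => h ε (T z)) ≤ 2 ^ d * M := by
    rw [hh, hM]
    exact sum_lipNorm_le_of_absSumming (u := fun ψ z => ψ (T z)) hq hC hu he
  have hd : (0 : ℝ) < 2 ^ d := by positivity
  refine le_of_mul_le_mul_left ?_ hd
  calc 2 ^ d * ∑ i, ‖v i‖ ≤ ∑ i, 8 * ∑ ε, |h ε (v i)| := by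
        rw [Finset.mul_sum]
        exact Finset.sum_le_sum fun i _ => hlower i
    _ = 8 * ∑ ε, ∑ i, |h ε (v i)| := by rw [← Finset.mul_sum, Finset.sum_comm]
    _ ≤ 8 * ∑ ε, (lipNorm (fun z => h ε (T z)) + 1) * S := by
        gcongr with ε
        exact hupper ε
    _ = 8 * ((∑ ε, lipNorm (fun z => h ε (T z)) + 2 ^ d) * S) := by
        rw [← Finset.sum_mul, Finset.sum_add_distrib]
        simp
    _ ≤ 8 * ((2 ^ d * M + 2 ^ d) * S) := by gcongr
    _ = 2 ^ d * (8 * (M + 1) * S) := by ring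
end

section
/- Let X be a real Banach space and H a real Hilbert space. If T : X → H is a bounded linear operator whose adjoint T* : H* → X* is almost summing (i.e., almost 2-summing), then T is absolutely 1-summing. -/
open scoped BigOperators

/-- The Rademacher average `(2^{-n} ∑_{ε ∈ {−1,1}^n} ‖∑ εᵢ yᵢ‖²)^{1/2}`. -/
noncomputable def radAvg {F : Type*} [NormedAddCommGroup F] [NormedSpace ℝ F]
    {n : ℕ} (y : Fin n → F) : ℝ :=
  Real.sqrt ((2 ^ n : ℝ)⁻¹ *
    ∑ ε : Fin n → Bool, ‖∑ i, (if ε i then (1 : ℝ) else -1) • y i‖ ^ 2)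

/-- A map `u : E → F` is almost `p`-summing. For `p = 2` this is the notion of an
almost summing operator. -/
def AlmostSumming (p : ℝ) {E F : Type*} [NormedAddCommGroup E] [NormedSpace ℝ E]
    [NormedAddCommGroup F] [NormedSpace ℝ F] (u : E → F) : Prop :=
  ∃ C : ℝ, 0 ≤ C ∧ ∀ (n : ℕ) (x : Fin n → E),
    radAvg (fun i => u (x i)) ≤ C * weakNorm p x

/-- A map `u : E → F` is absolutely `1`-summing. -/
def AbsolutelyOneSumming {E F : Type*} [NormedAddCommGroup E] [NormedSpace ℝ E]
    [NormedAddCommGroup F] (u : E → F) : Prop :=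
  ∃ C : ℝ, 0 ≤ C ∧ ∀ (n : ℕ) (x : Fin n → E),
    ∑ i, ‖u (x i)‖ ≤ C * weakNorm 1 x

theorem sum_bool_fun_succ {M : Type*} [AddCommMonoid M] {n : ℕ} (f : (Fin (n + 1) → Bool) → M) :
    ∑ ε, f ε = ∑ ε : Fin n → Bool,
      (f (Fin.cons true ε : Fin (n + 1) → Bool) + f (Fin.cons false ε : Fin (n + 1) → Bool)) := by
  rw [← (Fin.consEquiv fun _ : Fin (n + 1) => Bool).sum_comp, Fintype.sum_prod_type,
    Fintype.sum_bool, ← Finset.sum_add_distrib]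
  rfl

/-- The second moment of a Rademacher sum. -/
theorem sum_rademacher_sq {n : ℕ} (a : Fin n → ℝ) :
    ∑ ε : Fin n → Bool, (∑ i, (if ε i then (1 : ℝ) else -1) * a i) ^ 2 =
      2 ^ n * ∑ i, a i ^ 2 := by
  induction n with
  | zero => simp
  | succ n ih =>
    rw [sum_bool_fun_succ]
    simp only [Fin.sum_univ_succ, Fin.cons_zero, Fin.cons_succ, if_true, Bool.false_eq_true,
      if_false]
    have h : ∀ s : ℝ, (1 * a 0 + s) ^ 2 + (-1 * a 0 + s) ^ 2 = 2 * s ^ 2 + 2 * a 0 ^ 2 :=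
      fun s => by ring
    simp only [h, Finset.sum_add_distrib, ← Finset.mul_sum, ih (fun i => a i.succ)]
    simp
    ring

/-- The fourth moment of a Rademacher sum is at most three times the square of the second. -/
theorem sum_rademacher_pow_four_le {n : ℕ} (a : Fin n → ℝ) :
    ∑ ε : Fin n → Bool, (∑ i, (if ε i then (1 : ℝ) else -1) * a i) ^ 4 ≤
      2 ^ n * (3 * (∑ i, a i ^ 2) ^ 2) := by
  induction n with
  | zero => simp
  | succ n ih =>
    rw [sum_bool_fun_succ]
    simp only [Fin.sum_univ_succ, Fin.cons_zero, Fin.cons_succ, if_true, Bool.false_eq_true,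
      if_false]
    have h : ∀ s : ℝ, (1 * a 0 + s) ^ 4 + (-1 * a 0 + s) ^ 4 =
        2 * s ^ 4 + 12 * a 0 ^ 2 * s ^ 2 + 2 * a 0 ^ 4 := fun s => by ring
    simp only [h, Finset.sum_add_distrib, ← Finset.mul_sum,
      sum_rademacher_sq (fun i => a i.succ)]
    have h4 := ih (fun i => a i.succ)
    have hpos : (0 : ℝ) ≤ 2 ^ n * a 0 ^ 4 := by positivity
    simp only [Finset.sum_const, Finset.card_univ, Fintype.card_fun, Fintype.card_bool,
      Fintype.card_fin, nsmul_eq_mul, Nat.cast_pow, Nat.cast_ofNat]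
    rw [pow_succ 2 n]
    linarith

/-- Khinchine's inequality: the `ℓ₂` norm is controlled by the first Rademacher moment. -/
theorem khinchine_one {n : ℕ} (a : Fin n → ℝ) :
    2 ^ n * √(∑ i, a i ^ 2) ≤
      4 * ∑ ε : Fin n → Bool, |∑ i, (if ε i then (1 : ℝ) else -1) * a i| := by
  set S : (Fin n → Bool) → ℝ := fun ε => ∑ i, (if ε i then (1 : ℝ) else -1) * a i with hS
  set σ := √(∑ i, a i ^ 2) with hσ
  have hσ2 : σ ^ 2 = ∑ i, a i ^ 2 := Real.sq_sqrt (by positivity)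
  change 2 ^ n * σ ≤ 4 * ∑ ε, |S ε|
  rcases (show 0 ≤ σ from Real.sqrt_nonneg _).eq_or_lt with h0 | h0
  · rw [← h0, mul_zero]
    positivity
  have h2 : ∑ ε, S ε ^ 2 = 2 ^ n * σ ^ 2 := by rw [hσ2]; exact sum_rademacher_sq a
  have h4 : ∑ ε, S ε ^ 4 ≤ 2 ^ n * (3 * (σ ^ 2) ^ 2) := by
    rw [hσ2]; exact sum_rademacher_pow_four_le a
  have hpt : ∀ ε, 4 * σ ^ 2 * S ε ^ 2 ≤ S ε ^ 4 + 4 * σ ^ 3 * |S ε| := by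
    intro ε
    have hu : 0 ≤ |S ε| := abs_nonneg _
    rw [← sq_abs (S ε), show S ε ^ 4 = |S ε| ^ 4 from (Even.pow_abs (by decide) _).symm]
    have hcube : 0 ≤ |S ε| ^ 3 - 4 * σ ^ 2 * |S ε| + 4 * σ ^ 3 := by
      nlinarith [mul_nonneg hu (sq_nonneg (|S ε| - 5 / 4 * σ)),
        mul_nonneg h0.le (sq_nonneg (|S ε| - 5 / 4 * σ)),
        mul_nonneg hu (sq_nonneg (|S ε| - σ)), mul_nonneg h0.le (sq_nonneg (|S ε| - σ)),
        pow_pos h0 3]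
    nlinarith [mul_nonneg hu hcube]
  have hsum := Finset.sum_le_sum fun ε (_ : ε ∈ Finset.univ) => hpt ε
  rw [Finset.sum_add_distrib, ← Finset.mul_sum, ← Finset.mul_sum, h2] at hsum
  have h3 : 0 < σ ^ 3 := pow_pos h0 3
  refine le_of_mul_le_mul_left ?_ h3
  nlinarith

/-- Functionals of norm at most one are dominated by the weak `ℓ₁` norm. -/
theorem sum_abs_le_norm_mul_weakNorm {E : Type*} [NormedAddCommGroup E] [NormedSpace ℝ E]
    {n : ℕ} (x : Fin n → E) (φ : E →L[ℝ] ℝ) :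
    ∑ i, |φ (x i)| ≤ ‖φ‖ * weakNorm 1 x := by
  have hbdd : BddAbove (Set.range fun φ : {φ : E →L[ℝ] ℝ // ‖φ‖ ≤ 1} =>
      (∑ i, |φ.1 (x i)| ^ (1 : ℝ)) ^ (1 / (1 : ℝ))) := by
    refine ⟨∑ i, ‖x i‖, ?_⟩
    rintro _ ⟨φ, rfl⟩
    simp only [Real.rpow_one, div_one]
    exact Finset.sum_le_sum fun i _ => by simpa using φ.1.le_of_opNorm_le φ.2 (x i)
  rcases eq_or_ne φ 0 with rfl | hφ
  · simp
  have hpos : 0 < ‖φ‖ := norm_pos_iff.mpr hφ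
  have hunit : ‖(‖φ‖⁻¹ • φ : E →L[ℝ] ℝ)‖ ≤ 1 := by
    rw [norm_smul, norm_inv, norm_norm, inv_mul_cancel₀ hpos.ne']
  have h := le_ciSup hbdd ⟨‖φ‖⁻¹ • φ, hunit⟩
  simp only [Real.rpow_one, div_one, smul_apply, smul_eq_mul,
    abs_mul, abs_inv, abs_norm, ← Finset.mul_sum] at h
  rw [inv_mul_le_iff₀ hpos] at h
  simpa [weakNorm] using h

/-- An orthonormal family, viewed in the dual, has weak `ℓ₂` norm at most one. -/
theorem weakNorm_two_innerSL_le_one {H : Type*} [NormedAddCommGroup H] [InnerProductSpace ℝ H]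
    {m : ℕ} {e : Fin m → H} (he : Orthonormal ℝ e) :
    weakNorm 2 (fun j => innerSL ℝ (e j)) ≤ 1 := by
  refine Real.iSup_le (fun φ => ?_) zero_le_one
  set c : Fin m → ℝ := fun j => φ.1 (innerSL ℝ (e j)) with hc
  have hs0 : 0 ≤ ∑ j, c j ^ 2 := by positivity
  have hnorm : ‖∑ j, c j • e j‖ ^ 2 = ∑ j, c j ^ 2 := by
    rw [← real_inner_self_eq_norm_sq, he.inner_sum]
    simp [sq]
  have hval : φ.1 (innerSL ℝ (∑ j, c j • e j)) = ∑ j, c j ^ 2 := by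
    simp [map_sum, hc, sq]
  have hle : ∑ j, c j ^ 2 ≤ ‖∑ j, c j • e j‖ := by
    rw [← hval]
    refine (le_abs_self _).trans ?_
    refine (φ.1.le_of_opNorm_le φ.2 (innerSL ℝ (∑ j, c j • e j))).trans_eq ?_
    rw [one_mul, innerSL_apply_norm]
  have h1 : ∑ j, c j ^ 2 ≤ 1 := by
    have := norm_nonneg (∑ j, c j • e j)
    nlinarith
  have : ∑ j, |φ.1 (innerSL ℝ (e j))| ^ (2 : ℝ) = ∑ j, c j ^ 2 := by
    simp [hc]
  rw [this]
  exact Real.rpow_le_one hs0 h1 (by norm_num)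

/-- The first Rademacher moment is at most the second. -/
theorem sum_norm_rademacher_le {F : Type*} [NormedAddCommGroup F] [NormedSpace ℝ F]
    {n : ℕ} (y : Fin n → F) :
    ∑ ε : Fin n → Bool, ‖∑ i, (if ε i then (1 : ℝ) else -1) • y i‖ ≤ 2 ^ n * radAvg y := by
  have h := sq_sum_le_card_mul_sum_sq (s := (Finset.univ : Finset (Fin n → Bool)))
    (f := fun ε => ‖∑ i, (if ε i then (1 : ℝ) else -1) • y i‖)
  simp only [Finset.card_univ, Fintype.card_fun, Fintype.card_bool, Fintype.card_fin,
    Nat.cast_pow, Nat.cast_ofNat] at h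
  refine le_of_sq_le_sq ?_ (by unfold radAvg; positivity)
  rw [mul_pow, radAvg, Real.sq_sqrt (by positivity)]
  refine h.trans_eq ?_
  field_simp

/-- If `X` is a real Banach space, `H` a real Hilbert space and `T : X → H` a bounded linear
operator whose adjoint `T* : H* → X*`, `ψ ↦ ψ ∘ T`, is almost summing (= almost `2`-summing),
then `T` is absolutely `1`-summing. -/
theorem kwapien_almost_summing {X H : Type*}
    [NormedAddCommGroup X] [NormedSpace ℝ X] [CompleteSpace X]
    [NormedAddCommGroup H] [InnerProductSpace ℝ H] [CompleteSpace H]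
    (T : X →L[ℝ] H)
    (hadj : AlmostSumming 2 (fun ψ : H →L[ℝ] ℝ => ψ.comp T)) :
    AbsolutelyOneSumming (fun x => T x) := by
  obtain ⟨C, hC0, hC⟩ := hadj
  refine ⟨4 * C, by positivity, fun n x => ?_⟩
  have hw : 0 ≤ weakNorm 1 x := Real.iSup_nonneg fun φ => by positivity
  let V := Submodule.span ℝ (Set.range fun i => T (x i))
  have : FiniteDimensional ℝ V := FiniteDimensional.span_of_finite ℝ (Set.finite_range _)
  let b := stdOrthonormalBasis ℝ V
  let m := Module.finrank ℝ V
  let e : Fin m → H := fun j => (b j : H)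
  have he : Orthonormal ℝ e := b.orthonormal.comp_linearIsometry V.subtypeₗᵢ
  let y : Fin m → (X →L[ℝ] ℝ) := fun j => (innerSL ℝ (e j)).comp T
  have hrad : radAvg y ≤ C :=
    (hC m fun j => innerSL ℝ (e j)).trans
      (mul_le_of_le_one_right hC0 (weakNorm_two_innerSL_le_one he))
  have hnorm : ∀ i, ‖T (x i)‖ = √(∑ j, y j (x i) ^ 2) := by
    intro i
    have hmem : T (x i) ∈ V := Submodule.subset_span ⟨i, rfl⟩
    have h := b.sum_sq_norm_inner_right ⟨T (x i), hmem⟩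
    rw [eq_comm, Real.sqrt_eq_iff_mul_self_eq (by positivity) (norm_nonneg _), ← sq]
    simpa [y, e] using h
  have hmain : 2 ^ m * ∑ i, ‖T (x i)‖ ≤ 2 ^ m * (4 * C * weakNorm 1 x) := by
    calc 2 ^ m * ∑ i, ‖T (x i)‖
        ≤ ∑ i, 4 * ∑ ε : Fin m → Bool, |∑ j, (if ε j then (1 : ℝ) else -1) * y j (x i)| := by
          rw [Finset.mul_sum]
          refine Finset.sum_le_sum fun i _ => ?_
          rw [hnorm]
          exact khinchine_one _
      _ = 4 * ∑ ε : Fin m → Bool,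
            ∑ i, |(∑ j, (if ε j then (1 : ℝ) else -1) • y j) (x i)| := by
          rw [← Finset.mul_sum, Finset.sum_comm]
          simp only [sum_apply, smul_apply, smul_eq_mul]
      _ ≤ 4 * ∑ ε : Fin m → Bool,
            ‖∑ j, (if ε j then (1 : ℝ) else -1) • y j‖ * weakNorm 1 x := by
          gcongr
          exact sum_abs_le_norm_mul_weakNorm x _
      _ ≤ 4 * (2 ^ m * C * weakNorm 1 x) := by
          rw [← Finset.sum_mul]
          gcongr
          exact (sum_norm_rademacher_le y).trans (by gcongr)
      _ = 2 ^ m * (4 * C * weakNorm 1 x) := by ring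
  exact le_of_mul_le_mul_left hmain (by positivity)
end

section
/- Let X be a real Banach space, 2 ≤ p < ∞, λ > 1, and let Y be a real Banach space that is an L_{p,λ}-space. If T : X → Y is a bounded linear operator whose adjoint T* : Y* → X* is almost p-summing with constant π_{al.s.p}(T*), then T is absolutely 1-summing with constant at most √2 · λ · π_{al.s.p}(T*); that is, ∑_{i=1}^n ‖T(xᵢ)‖ ≤ √2 · λ · π_{al.s.p}(T*) · sup_{φ ∈ X*, ‖φ‖ ≤ 1} ∑_{i=1}^n |φ(xᵢ)| for all finite families x₁,…,xₙ ∈ X. -/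
open scoped BigOperators

/-- `π_{al.s.p}(u)`: the infimum of the constants witnessing that `u` is almost `p`-summing. -/
noncomputable def almostSummingConst (p : ℝ) {E F : Type*} [NormedAddCommGroup E]
    [NormedSpace ℝ E] [NormedAddCommGroup F] [NormedSpace ℝ F] (u : E → F) : ℝ :=
  sInf {C : ℝ | 0 ≤ C ∧ ∀ (n : ℕ) (x : Fin n → E),
    radAvg (fun i => u (x i)) ≤ C * weakNorm p x}

/-- The `ℓ_p` norm on `ℝ^m`. -/
noncomputable def lpNorm (p : ℝ) {m : ℕ} (y : Fin m → ℝ) : ℝ :=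
  (∑ k, |y k| ^ p) ^ (1 / p)

/-- `Y` is an `L_{p,λ}`-space: every finite-dimensional subspace `E` of `Y` is contained in a
finite-dimensional subspace `Y₀` admitting a linear isomorphism `v : Y₀ → ℓ_p^{dim Y₀}` with
`‖v‖ ⬝ ‖v⁻¹‖ ≤ λ`. -/
def IsLpSpaceWith (p lam : ℝ) (Y : Type*) [NormedAddCommGroup Y] [NormedSpace ℝ Y] : Prop :=
  ∀ E : Submodule ℝ Y, FiniteDimensional ℝ E →
    ∃ Y₀ : Submodule ℝ Y, E ≤ Y₀ ∧ FiniteDimensional ℝ Y₀ ∧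
      ∃ v : Y₀ ≃ₗ[ℝ] (Fin (Module.finrank ℝ Y₀) → ℝ), ∃ a b : ℝ,
        (∀ y : Y₀, lpNorm p (v y) ≤ a * ‖y‖) ∧
        (∀ z : Fin (Module.finrank ℝ Y₀) → ℝ, ‖v.symm z‖ ≤ b * lpNorm p z) ∧
        a * b ≤ lam

/-- Summation over the sign cube, split along the first coordinate. -/
theorem sum_boolCube_succ {n : ℕ} (f : (Fin (n + 1) → Bool) → ℝ) :
    ∑ ε, f ε = ∑ ε : Fin n → Bool,
      (f (Fin.cons true ε : Fin (n + 1) → Bool) + f (Fin.cons false ε : Fin (n + 1) → Bool)) := by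
  rw [← (Fin.consEquiv (fun _ : Fin (n + 1) => Bool)).sum_comp, Fintype.sum_prod_type,
    Fintype.sum_bool, Finset.sum_add_distrib]
  rfl

theorem sum_boolCube_comp_not {n : ℕ} (f : (Fin n → Bool) → ℝ) :
    ∑ ε : Fin n → Bool, f (fun i => !ε i) = ∑ ε, f ε := by
  have h : Function.Involutive (fun (ε : Fin n → Bool) i => !ε i) := fun ε => by
    funext i
    simp
  exact h.bijective.sum_comp f

theorem sq_sum_le_of_even_part {n : ℕ} (h : (Fin n → Bool) → ℝ) :
    2 * (2 ^ n : ℝ)⁻¹ * (∑ ε, h ε) ^ 2 ≤ ∑ ε, (h ε ^ 2 + h ε * h (fun i => !ε i)) := by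
  have h1 := sq_sum_le_card_mul_sum_sq (s := (Finset.univ : Finset (Fin n → Bool)))
    (f := fun ε => h ε + h (fun i => !ε i))
  have h2 : ∑ ε, (h ε + h (fun i => !ε i)) = 2 * ∑ ε, h ε := by
    rw [Finset.sum_add_distrib, sum_boolCube_comp_not h]; ring
  have h3 : ∑ ε, (h ε + h (fun i => !ε i)) ^ 2
      = 2 * ∑ ε, (h ε ^ 2 + h ε * h (fun i => !ε i)) := by
    have h4 := sum_boolCube_comp_not (fun ε => h ε ^ 2)
    simp only [add_sq, Finset.sum_add_distrib, mul_add] at h4 ⊢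
    rw [h4, Finset.mul_sum (f := fun ε => h ε * h (fun i => !ε i))]
    simp only [mul_assoc]
    ring
  rw [h2, h3] at h1
  simp only [Finset.card_univ, Fintype.card_fun, Fintype.card_bool, Fintype.card_fin] at h1
  push_cast at h1
  have hpos : (0 : ℝ) < 2 ^ n := by positivity
  rw [mul_comm (2 : ℝ), mul_assoc, inv_mul_le_iff₀ hpos]
  linarith

/-- The Dirichlet form of the discrete cube. -/
noncomputable def cubeDirichlet {n : ℕ} (f : (Fin n → Bool) → ℝ) : ℝ :=
  ∑ ε, ∑ i, f ε * (f ε - f (Function.update ε i (!ε i)))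

theorem cubeDirichlet_succ {n : ℕ} (f : (Fin (n + 1) → Bool) → ℝ) :
    cubeDirichlet f = cubeDirichlet (fun ε : Fin n → Bool => f (Fin.cons true ε))
      + cubeDirichlet (fun ε : Fin n → Bool => f (Fin.cons false ε))
      + ∑ ε : Fin n → Bool, (f (Fin.cons true ε) - f (Fin.cons false ε)) ^ 2 := by
  unfold cubeDirichlet
  rw [sum_boolCube_succ, ← Finset.sum_add_distrib, ← Finset.sum_add_distrib]
  refine Finset.sum_congr rfl fun ε _ => ?_
  simp only [Fin.sum_univ_succ, Fin.cons_zero, Fin.cons_succ, Fin.update_cons_zero,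
    ← Fin.cons_update, Bool.not_true, Bool.not_false]
  ring

theorem cubeDirichlet_parallelogram {n : ℕ} (f g : (Fin n → Bool) → ℝ) :
    2 * (cubeDirichlet f + cubeDirichlet g)
      = cubeDirichlet (fun ε => f ε + g ε) + cubeDirichlet (fun ε => f ε - g ε) := by
  unfold cubeDirichlet
  simp only [Finset.mul_sum, ← Finset.sum_add_distrib]
  refine Finset.sum_congr rfl fun ε _ => Finset.sum_congr rfl fun i _ => ?_
  ring

/-- A Poincaré inequality on the discrete cube with an improved constant on even functions. -/
theorem cubeDirichlet_ge {n : ℕ} (f : (Fin n → Bool) → ℝ) :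
    3 * ∑ ε, f ε ^ 2 + ∑ ε, f ε * f (fun i => !ε i) - 4 * (2 ^ n : ℝ)⁻¹ * (∑ ε, f ε) ^ 2
      ≤ cubeDirichlet f := by
  induction n with
  | zero =>
    have h : ∀ ε : Fin 0 → Bool, f ε = f Fin.elim0 := fun ε => by
      congr 1; exact Subsingleton.elim _ _
    simp only [cubeDirichlet, h]
    simp
    nlinarith
  | succ n ih =>
    set a : (Fin n → Bool) → ℝ := fun ε => f (Fin.cons true ε) with ha
    set b : (Fin n → Bool) → ℝ := fun ε => f (Fin.cons false ε) with hb
    have hnot : ∀ (c : Bool) (ε : Fin n → Bool),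
        (fun i => !(Fin.cons c ε : Fin (n + 1) → Bool) i) = Fin.cons (!c) (fun i => !ε i) := by
      intro c ε
      funext i
      refine Fin.cases ?_ (fun j => ?_) i <;> simp
    have e1 := cubeDirichlet_succ f
    have e2 := cubeDirichlet_parallelogram a b
    have i1 := ih (fun ε => a ε + b ε)
    have i2 := ih (fun ε => a ε - b ε)
    have i3 := sq_sum_le_of_even_part (fun ε => a ε - b ε)
    have s1 := sum_boolCube_succ (fun ε => f ε ^ 2)
    have s2 := sum_boolCube_succ (fun ε => f ε * f (fun i => !ε i))
    have s3 := sum_boolCube_succ f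
    simp only [hnot, Bool.not_true, Bool.not_false] at s2
    rw [s1, s2, s3, e1]
    change _ ≤ cubeDirichlet a + cubeDirichlet b + ∑ ε, (a ε - b ε) ^ 2
    change 3 * ∑ ε, (a ε ^ 2 + b ε ^ 2) + ∑ ε, (a ε * b (fun i => !ε i) + b ε * a (fun i => !ε i))
      - 4 * (2 ^ (n + 1) : ℝ)⁻¹ * (∑ ε, (a ε + b ε)) ^ 2 ≤ _
    have q1 : ∑ ε, (a ε + b ε) ^ 2 + ∑ ε, (a ε - b ε) ^ 2 = 2 * ∑ ε, (a ε ^ 2 + b ε ^ 2) := by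
      rw [← Finset.sum_add_distrib, Finset.mul_sum]
      exact Finset.sum_congr rfl fun ε _ => by ring
    have q2 : ∑ ε, (a ε + b ε) * (a (fun i => !ε i) + b (fun i => !ε i))
        - ∑ ε, (a ε - b ε) * (a (fun i => !ε i) - b (fun i => !ε i))
        = 2 * ∑ ε, (a ε * b (fun i => !ε i) + b ε * a (fun i => !ε i)) := by
      rw [← Finset.sum_sub_distrib, Finset.mul_sum]
      exact Finset.sum_congr rfl fun ε _ => by ring
    have q3 : (2 ^ (n + 1) : ℝ)⁻¹ = (2 ^ n : ℝ)⁻¹ / 2 := by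
      rw [pow_succ, mul_inv]; ring
    rw [Finset.sum_add_distrib] at i3
    rw [q3]
    set A := (2 ^ n : ℝ)⁻¹ * (∑ ε, (a ε + b ε)) ^ 2 with hA
    set B := (2 ^ n : ℝ)⁻¹ * (∑ ε, (a ε - b ε)) ^ 2 with hB
    have r1 : 4 * ((2 ^ n : ℝ)⁻¹ / 2) * (∑ ε, (a ε + b ε)) ^ 2 = 2 * A := by rw [hA]; ring
    rw [r1]
    rw [mul_assoc, ← hA] at i1
    rw [mul_assoc, ← hB] at i2 i3
    linarith

theorem sum_boolCube_affine_sq {n : ℕ} (a : Fin n → ℝ) (c : ℝ) :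
    ∑ ε : Fin n → Bool, (c + ∑ i, (if ε i then (1 : ℝ) else -1) * a i) ^ 2
      = 2 ^ n * (c ^ 2 + ∑ i, a i ^ 2) := by
  induction n generalizing c with
  | zero => simp
  | succ n ih =>
    rw [sum_boolCube_succ, Finset.sum_add_distrib]
    simp only [Fin.sum_univ_succ, Fin.cons_zero, Fin.cons_succ, ← add_assoc, if_true]
    rw [ih, ih]
    simp
    ring

/-- Khintchine's inequality in `L₁` with the optimal constant `√2`. -/
theorem khintchine_one {n : ℕ} (a : Fin n → ℝ) :
    Real.sqrt (∑ i, a i ^ 2) ≤ Real.sqrt 2 * ((2 ^ n : ℝ)⁻¹ *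
      ∑ ε : Fin n → Bool, |∑ i, (if ε i then (1 : ℝ) else -1) * a i|) := by
  set s : (Fin n → Bool) → ℝ := fun ε => ∑ i, (if ε i then (1 : ℝ) else -1) * a i with hs
  have hflip : ∀ ε i, s (Function.update ε i (!ε i))
      = s ε - 2 * ((if ε i then (1 : ℝ) else -1) * a i) := by
    intro ε i
    simp only [hs]
    rw [← Finset.add_sum_erase _ _ (Finset.mem_univ i),
      ← Finset.add_sum_erase Finset.univ
        (fun j => (if ε j then (1 : ℝ) else -1) * a j) (Finset.mem_univ i)]
    have : ∑ j ∈ Finset.univ.erase i, (if Function.update ε i (!ε i) j then (1 : ℝ) else -1) * a j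
        = ∑ j ∈ Finset.univ.erase i, (if ε j then (1 : ℝ) else -1) * a j := by
      refine Finset.sum_congr rfl fun j hj => ?_
      rw [Function.update_of_ne (Finset.ne_of_mem_erase hj)]
    rw [this, Function.update_self]
    cases ε i <;> simp <;> ring
  have hneg : ∀ ε : Fin n → Bool, s (fun i => !ε i) = -s ε := by
    intro ε
    simp only [hs, ← Finset.sum_neg_distrib]
    refine Finset.sum_congr rfl fun i _ => ?_
    by_cases h : ε i <;> simp [h]
  have hsum : ∀ ε, ∑ i, s (Function.update ε i (!ε i)) = (n - 2) * s ε := by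
    intro ε
    simp only [hflip, Finset.sum_sub_distrib, ← Finset.mul_sum]
    simp [hs]
    ring
  have hle : ∀ ε, ∑ i, |s ε| * (|s ε| - |s (Function.update ε i (!ε i))|) ≤ 2 * |s ε| ^ 2 := by
    intro ε
    rw [← Finset.mul_sum, Finset.sum_sub_distrib]
    have h1 : |∑ i, s (Function.update ε i (!ε i))| ≤ ∑ i, |s (Function.update ε i (!ε i))| :=
      Finset.abs_sum_le_sum_abs _ _
    rw [hsum, abs_mul] at h1
    have h2 : ((n : ℝ) - 2) * |s ε| ≤ |(n : ℝ) - 2| * |s ε| :=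
      mul_le_mul_of_nonneg_right (le_abs_self _) (abs_nonneg _)
    simp only [Finset.sum_const, Finset.card_univ, Fintype.card_fin, nsmul_eq_mul]
    nlinarith [abs_nonneg (s ε)]
  have hD := cubeDirichlet_ge (fun ε => |s ε|)
  have hD' : cubeDirichlet (fun ε => |s ε|) ≤ 2 * ∑ ε, |s ε| ^ 2 := by
    rw [Finset.mul_sum]
    exact Finset.sum_le_sum fun ε _ => hle ε
  simp only [hneg, abs_neg, ← sq] at hD
  have hsq : ∑ ε, |s ε| ^ 2 = 2 ^ n * ∑ i, a i ^ 2 := by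
    simpa [hs] using sum_boolCube_affine_sq a 0
  rw [hsq] at hD hD'
  have hpos : (0 : ℝ) < 2 ^ n := by positivity
  refine Real.sqrt_le_iff.mpr ⟨by positivity, ?_⟩
  rw [mul_pow, Real.sq_sqrt (by norm_num), mul_pow]
  have h3 : 2 ^ n * ∑ i, a i ^ 2 ≤ 2 * (2 ^ n : ℝ)⁻¹ * (∑ ε, |s ε|) ^ 2 := by linarith
  calc ∑ i, a i ^ 2 = (2 ^ n : ℝ)⁻¹ * (2 ^ n * ∑ i, a i ^ 2) := by field_simp
    _ ≤ (2 ^ n : ℝ)⁻¹ * (2 * (2 ^ n : ℝ)⁻¹ * (∑ ε, |s ε|) ^ 2) := by gcongr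
    _ = _ := by ring

theorem lpNorm_nonneg (p : ℝ) {m : ℕ} (z : Fin m → ℝ) : 0 ≤ lpNorm p z :=
  Real.rpow_nonneg (Finset.sum_nonneg fun _ _ => Real.rpow_nonneg (abs_nonneg _) _) _

theorem lpNorm_rpow {p : ℝ} (hp : 0 < p) {m : ℕ} (z : Fin m → ℝ) :
    lpNorm p z ^ p = ∑ k, |z k| ^ p := by
  rw [lpNorm, one_div, Real.rpow_inv_rpow _ hp.ne']
  exact Finset.sum_nonneg fun _ _ => Real.rpow_nonneg (abs_nonneg _) _

theorem lpNorm_smul {p : ℝ} (hp : 0 < p) {m : ℕ} (c : ℝ) (z : Fin m → ℝ) :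
    lpNorm p (c • z) = |c| * lpNorm p z := by
  unfold lpNorm
  simp only [Pi.smul_apply, smul_eq_mul, abs_mul, Real.mul_rpow (abs_nonneg _) (abs_nonneg _),
    ← Finset.mul_sum]
  rw [Real.mul_rpow (by positivity) (Finset.sum_nonneg fun _ _ => by positivity), one_div,
    Real.rpow_rpow_inv (abs_nonneg _) hp.ne']

theorem lpNorm_mono {p : ℝ} (hp : 0 < p) {m : ℕ} {z w : Fin m → ℝ} (h : ∀ k, |z k| ≤ |w k|) :
    lpNorm p z ≤ lpNorm p w := by
  unfold lpNorm
  refine Real.rpow_le_rpow (Finset.sum_nonneg fun _ _ => Real.rpow_nonneg (abs_nonneg _) _)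
    (Finset.sum_le_sum fun k _ => ?_) (by positivity)
  exact Real.rpow_le_rpow (abs_nonneg _) (h k) hp.le

theorem lpNorm_add_le {p : ℝ} (hp : 1 ≤ p) {m : ℕ} (z w : Fin m → ℝ) :
    lpNorm p (z + w) ≤ lpNorm p z + lpNorm p w :=
  Real.Lp_add_le Finset.univ z w hp

theorem lpNorm_le_sqrt {p : ℝ} (hp : 2 ≤ p) {m : ℕ} (z : Fin m → ℝ) :
    lpNorm p z ≤ Real.sqrt (∑ k, z k ^ 2) := by
  set M := Real.sqrt (∑ k, z k ^ 2) with hM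
  have hM0 : 0 ≤ M := Real.sqrt_nonneg _
  have hp0 : 0 < p := by linarith
  have hz : ∀ k, |z k| ≤ M := fun k => by
    rw [← Real.sqrt_sq_eq_abs]
    exact Real.sqrt_le_sqrt
      (Finset.single_le_sum (f := fun k => z k ^ 2) (fun _ _ => sq_nonneg _) (Finset.mem_univ k))
  have hsplit : ∀ t : ℝ, 0 ≤ t → t ^ p = t ^ 2 * t ^ (p - 2) := fun t ht => by
    rw [← Real.rpow_two, ← Real.rpow_add_of_nonneg ht (by norm_num) (by linarith)]
    congr 1; ring
  rw [← Real.rpow_le_rpow_iff (lpNorm_nonneg p z) hM0 hp0, lpNorm_rpow hp0, hsplit M hM0]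
  have : M ^ 2 = ∑ k, z k ^ 2 := Real.sq_sqrt (Finset.sum_nonneg fun _ _ => sq_nonneg _)
  rw [this, Finset.sum_mul]
  refine Finset.sum_le_sum fun k _ => ?_
  rw [hsplit _ (abs_nonneg _), sq_abs]
  gcongr
  exact hz k

/-- The weighted averaging operator attached to a density `F` and a partition `β`. -/
noncomputable def blockAverage (p : ℝ) {m N : ℕ} (F : Fin m → ℝ) (β : Fin m → Fin N) :
    (Fin m → ℝ) →ₗ[ℝ] (Fin N → ℝ) where
  toFun z B := (∑ k with β k = B, F k ^ p) ^ (1 / p - 1) * ∑ k with β k = B, F k ^ (p - 1) * z k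
  map_add' z w := by
    funext B
    simp only [Pi.add_apply, mul_add, Finset.sum_add_distrib]
  map_smul' c z := by
    funext B
    simp only [Pi.smul_apply, smul_eq_mul, RingHom.id_apply, Finset.mul_sum]
    exact Finset.sum_congr rfl fun k _ => by ring

theorem lpNorm_blockAverage_le {p : ℝ} (hp : 1 < p) {m N : ℕ} {F : Fin m → ℝ} (hF : ∀ k, 0 ≤ F k)
    (β : Fin m → Fin N) (z : Fin m → ℝ) : lpNorm p (blockAverage p F β z) ≤ lpNorm p z := by
  have hp0 : 0 < p := by linarith
  have hpq := Real.HolderConjugate.conjExponent hp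
  set q := p.conjExponent
  have hqe : (p - 1) * q = p := hpq.sub_one_mul_conj
  have hone : 1 / p - 1 + 1 / q = 0 := by
    have := hpq.inv_add_inv_eq_one
    rw [one_div, one_div]; linarith
  rw [← Real.rpow_le_rpow_iff (lpNorm_nonneg p _) (lpNorm_nonneg p _) hp0, lpNorm_rpow hp0,
    lpNorm_rpow hp0, ← Finset.sum_fiberwise Finset.univ β]
  refine Finset.sum_le_sum fun B _ => ?_
  set μ := ∑ k with β k = B, F k ^ p with hμ
  set S := ∑ k with β k = B, |z k| ^ p with hS
  have hμ0 : 0 ≤ μ := Finset.sum_nonneg fun k _ => Real.rpow_nonneg (hF k) _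
  have hS0 : 0 ≤ S := Finset.sum_nonneg fun k _ => Real.rpow_nonneg (abs_nonneg _) _
  have hH : |∑ k with β k = B, F k ^ (p - 1) * z k| ≤ μ ^ (1 / q) * S ^ (1 / p) := by
    have h := Real.inner_le_Lp_mul_Lq {k | β k = B} (fun k => F k ^ (p - 1)) (fun k => |z k|)
      hpq.symm
    have e : ∀ k, |F k ^ (p - 1)| ^ q = F k ^ p := fun k => by
      rw [abs_of_nonneg (Real.rpow_nonneg (hF k) _), ← Real.rpow_mul (hF k), hqe]
    simp only [e, abs_abs] at h
    refine (Finset.abs_sum_le_sum_abs _ _).trans (le_trans (le_of_eq ?_) h)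
    refine Finset.sum_congr rfl fun k _ => ?_
    rw [abs_mul, abs_of_nonneg (Real.rpow_nonneg (hF k) _)]
  have hle : |blockAverage p F β z B| ≤ S ^ (1 / p) := by
    change |μ ^ (1 / p - 1) * ∑ k with β k = B, F k ^ (p - 1) * z k| ≤ _
    rw [abs_mul, abs_of_nonneg (Real.rpow_nonneg hμ0 _)]
    rcases hμ0.eq_or_lt with h0 | h0
    · rw [← h0, Real.zero_rpow, zero_mul]
      · positivity
      · have : 0 < 1 / q := one_div_pos.mpr hpq.symm.pos
        linarith
    · calc _ ≤ μ ^ (1 / p - 1) * (μ ^ (1 / q) * S ^ (1 / p)) := by gcongr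
        _ = S ^ (1 / p) := by
          rw [← mul_assoc, ← Real.rpow_add h0, hone, Real.rpow_zero, one_mul]
  calc |blockAverage p F β z B| ^ p ≤ (S ^ (1 / p)) ^ p := by gcongr
    _ = S := by rw [one_div, Real.rpow_inv_rpow hS0 hp0.ne']

theorem lpNorm_blockAverage_of_adapted {p : ℝ} (hp : 1 < p) {m N : ℕ} {F : Fin m → ℝ}
    (hF : ∀ k, 0 ≤ F k) (β : Fin m → Fin N) (c : Fin N → ℝ) :
    lpNorm p (blockAverage p F β (fun k => c (β k) * F k)) = lpNorm p (fun k => c (β k) * F k) := by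
  have hp0 : 0 < p := by linarith
  have hF1 : ∀ k, F k ^ (p - 1) * F k = F k ^ p := fun k => by
    nth_rewrite 2 [← Real.rpow_one (F k)]
    rw [← Real.rpow_add_of_nonneg (hF k) (by linarith) (by norm_num)]
    congr 1; ring
  unfold lpNorm
  congr 1
  rw [← Finset.sum_fiberwise Finset.univ β]
  refine Finset.sum_congr rfl fun B _ => ?_
  set μ := ∑ k with β k = B, F k ^ p with hμ
  have hμ0 : 0 ≤ μ := Finset.sum_nonneg fun k _ => Real.rpow_nonneg (hF k) _
  have hb : blockAverage p F β (fun k => c (β k) * F k) B = c B * μ ^ (1 / p) := by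
    change μ ^ (1 / p - 1) * ∑ k with β k = B, F k ^ (p - 1) * (c (β k) * F k) = _
    have : ∑ k with β k = B, F k ^ (p - 1) * (c (β k) * F k) = c B * μ := by
      rw [hμ, Finset.mul_sum]
      refine Finset.sum_congr rfl fun k hk => ?_
      rw [(Finset.mem_filter.mp hk).2, ← hF1 k]
      ring
    rw [this]
    rcases hμ0.eq_or_lt with h0 | h0
    · rw [← h0, Real.zero_rpow (one_div_pos.mpr hp0).ne']; simp
    · rw [Real.rpow_sub h0, Real.rpow_one]; field_simp
  rw [hb, abs_mul, abs_of_nonneg (Real.rpow_nonneg hμ0 _), Real.mul_rpow (abs_nonneg _)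
    (Real.rpow_nonneg hμ0 _), one_div, Real.rpow_inv_rpow hμ0 hp0.ne', hμ, Finset.mul_sum]
  refine Finset.sum_congr rfl fun k hk => ?_
  beta_reduce
  rw [(Finset.mem_filter.mp hk).2, abs_mul, abs_of_nonneg (hF k),
    Real.mul_rpow (abs_nonneg _) (hF k)]

theorem exists_finite_net (n : ℕ) {ε : ℝ} (hε : 0 < ε) :
    ∃ (N : ℕ) (y : Fin N → Fin n → ℝ), ∀ u : Fin n → ℝ, (∀ i, |u i| ≤ 1) →
      ∃ B, ∀ i, |u i - y B i| ≤ ε := by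
  obtain ⟨t, -, htf, ht⟩ := (isCompact_closedBall (0 : Fin n → ℝ) 1).finite_cover_balls hε
  have := htf.fintype
  refine ⟨Fintype.card t, fun B => ((Fintype.equivFin t).symm B : Fin n → ℝ), fun u hu => ?_⟩
  have hu' : u ∈ Metric.closedBall (0 : Fin n → ℝ) 1 := by
    rw [mem_closedBall_zero_iff, pi_norm_le_iff_of_nonneg zero_le_one]
    exact hu
  obtain ⟨y, hy, huy⟩ := Set.mem_iUnion₂.mp (ht hu')
  refine ⟨Fintype.equivFin t ⟨y, hy⟩, fun i => ?_⟩
  beta_reduce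
  rw [Equiv.symm_apply_apply]
  exact (dist_le_pi_dist u y i).trans (Metric.mem_ball.mp huy).le

/-- Finitely many vectors of `ℓ_p^m` are almost preserved by a contraction onto `ℓ_p^N`, where `N`
does not depend on `m`. -/
theorem exists_uniform_contraction {p : ℝ} (hp : 1 < p) (n : ℕ) {ε : ℝ} (hε : 0 < ε) :
    ∃ N : ℕ, ∀ (m : ℕ) (f : Fin n → Fin m → ℝ), ∃ Q : (Fin m → ℝ) →ₗ[ℝ] (Fin N → ℝ),
      (∀ z, lpNorm p (Q z) ≤ lpNorm p z) ∧
      ∀ i, lpNorm p (f i) ≤ lpNorm p (Q (f i)) + ε * (∑ j, lpNorm p (f j) ^ p) ^ (1 / p) := by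
  have hp0 : 0 < p := by linarith
  obtain ⟨N, y, hy⟩ := exists_finite_net n (half_pos hε)
  refine ⟨N, fun m f => ?_⟩
  set F : Fin m → ℝ := fun k => (∑ j, |f j k| ^ p) ^ (1 / p) with hFdef
  have hF : ∀ k, 0 ≤ F k := fun k =>
    Real.rpow_nonneg (Finset.sum_nonneg fun _ _ => Real.rpow_nonneg (abs_nonneg _) _) _
  have hfF : ∀ i k, |f i k| ≤ F k := fun i k => by
    rw [← Real.rpow_rpow_inv (abs_nonneg (f i k)) hp0.ne', ← one_div]
    refine Real.rpow_le_rpow (Real.rpow_nonneg (abs_nonneg _) _) ?_ (by positivity)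
    exact Finset.single_le_sum (f := fun j => |f j k| ^ p)
      (fun _ _ => Real.rpow_nonneg (abs_nonneg _) _) (Finset.mem_univ i)
  have hFnorm : lpNorm p F = (∑ j, lpNorm p (f j) ^ p) ^ (1 / p) := by
    rw [lpNorm]
    congr 1
    simp only [lpNorm_rpow hp0]
    rw [Finset.sum_comm]
    refine Finset.sum_congr rfl fun k _ => ?_
    rw [abs_of_nonneg (hF k), hFdef]
    simp only
    rw [one_div, Real.rpow_inv_rpow _ hp0.ne']
    exact Finset.sum_nonneg fun _ _ => Real.rpow_nonneg (abs_nonneg _) _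
  have hβ : ∀ k, ∃ B, ∀ i, |f i k / F k - y B i| ≤ ε / 2 := fun k => by
    refine hy _ fun i => ?_
    rw [abs_div, abs_of_nonneg (hF k)]
    exact div_le_one_of_le₀ (hfF i k) (hF k)
  choose β hβ using hβ
  have hQ := lpNorm_blockAverage_le hp hF β
  refine ⟨blockAverage p F β, hQ, fun i => ?_⟩
  set z : Fin m → ℝ := fun k => y (β k) i * F k with hz
  set r : Fin m → ℝ := fun k => f i k - z k with hr
  have hrF : lpNorm p r ≤ ε / 2 * lpNorm p F := by
    rw [← abs_of_pos (half_pos hε), ← lpNorm_smul hp0]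
    refine lpNorm_mono hp0 fun k => ?_
    rw [Pi.smul_apply, smul_eq_mul, abs_mul, abs_of_pos (half_pos hε), abs_of_nonneg (hF k)]
    have hrk : r k = (f i k / F k - y (β k) i) * F k := by
      rcases (hF k).eq_or_lt with h0 | h0
      · have : f i k = 0 := abs_nonpos_iff.mp (h0 ▸ hfF i k)
        simp only [hr, hz, this, ← h0]
        ring
      · simp only [hr, hz]
        field_simp
    rw [hrk, abs_mul, abs_of_nonneg (hF k)]
    exact mul_le_mul_of_nonneg_right (hβ k i) (hF k)
  have hneg : lpNorm p (-r) = lpNorm p r := by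
    have := lpNorm_smul hp0 (-1) r
    simpa using this
  have h1 : lpNorm p (f i) ≤ lpNorm p z + lpNorm p r := by
    have := lpNorm_add_le hp.le z r
    rwa [show z + r = f i by funext k; simp [hr]] at this
  have h2 : lpNorm p z ≤ lpNorm p (blockAverage p F β (f i)) + lpNorm p r := by
    have := lpNorm_add_le hp.le (blockAverage p F β (f i)) (blockAverage p F β (-r))
    rw [← map_add, show f i + -r = z by funext k; simp [hr],
      lpNorm_blockAverage_of_adapted hp hF β (fun B => y B i)] at this
    have h3 := hQ (-r)
    rw [hneg] at h3
    linarith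
  rw [← hFnorm]
  linarith

theorem weakNorm_le_of_forall_lpNorm_le {p : ℝ} (hp : 1 < p) {Y : Type*} [NormedAddCommGroup Y]
    [NormedSpace ℝ Y] {N : ℕ} (ψ : Fin N → Y →L[ℝ] ℝ)
    (hψ : ∀ y, lpNorm p (fun B => ψ B y) ≤ ‖y‖) : weakNorm p ψ ≤ 1 := by
  have hp0 : 0 < p := by linarith
  have hpq := Real.HolderConjugate.conjExponent hp
  set q := p.conjExponent
  have : Nonempty {φ : (Y →L[ℝ] ℝ) →L[ℝ] ℝ // ‖φ‖ ≤ 1} :=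
    ⟨⟨0, (norm_zero (E := (Y →L[ℝ] ℝ) →L[ℝ] ℝ)).trans_le zero_le_one⟩⟩
  refine ciSup_le fun ⟨Φ, hΦ⟩ => ?_
  set t : Fin N → ℝ := fun B => Φ (ψ B) with ht
  set c : Fin N → ℝ := fun B => SignType.sign (t B) * |t B| ^ (p - 1) with hc
  set S := ∑ B, |t B| ^ p with hS
  have hS0 : 0 ≤ S := Finset.sum_nonneg fun _ _ => Real.rpow_nonneg (abs_nonneg _) _
  have hct : ∀ B, c B * t B = |t B| ^ p := fun B => by
    simp only [hc]
    rw [mul_right_comm, sign_mul_self]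
    nth_rewrite 1 [← Real.rpow_one |t B|]
    rw [← Real.rpow_add_of_nonneg (abs_nonneg _) (by norm_num) (by linarith)]
    congr 1; ring
  have hcq : ∀ B, |c B| ^ q ≤ |t B| ^ p := fun B => by
    have h1 : |c B| ≤ |t B| ^ (p - 1) := by
      simp only [hc, abs_mul]
      rw [abs_of_nonneg (Real.rpow_nonneg (abs_nonneg (t B)) _)]
      refine mul_le_of_le_one_left (Real.rpow_nonneg (abs_nonneg _) _) ?_
      rcases SignType.sign (t B) with _ | _ | _ <;> simp
    calc |c B| ^ q ≤ (|t B| ^ (p - 1)) ^ q :=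
          Real.rpow_le_rpow (abs_nonneg _) h1 hpq.symm.nonneg
      _ = |t B| ^ p := by rw [← Real.rpow_mul (abs_nonneg _), hpq.sub_one_mul_conj]
  have hnorm : ‖∑ B, c B • ψ B‖ ≤ S ^ (1 / q) := by
    refine ContinuousLinearMap.opNorm_le_bound _ (Real.rpow_nonneg hS0 _) fun y => ?_
    rw [Real.norm_eq_abs]
    have key : ∀ c' : Fin N → ℝ, (∀ B, |c' B| = |c B|) →
        ∑ B, c' B * ψ B y ≤ S ^ (1 / q) * ‖y‖ := fun c' hc' => by
      refine (Real.inner_le_Lp_mul_Lq Finset.univ c' (fun B => ψ B y) hpq.symm).trans ?_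
      refine mul_le_mul ?_ (hψ y) (lpNorm_nonneg p _) (Real.rpow_nonneg hS0 _)
      refine Real.rpow_le_rpow (Finset.sum_nonneg fun _ _ => Real.rpow_nonneg (abs_nonneg _) _)
        (Finset.sum_le_sum fun B _ => ?_) (one_div_nonneg.mpr hpq.symm.nonneg)
      rw [hc']
      exact hcq B
    simp only [sum_apply, smul_apply, smul_eq_mul]
    refine abs_le'.mpr ⟨key c fun _ => rfl, ?_⟩
    have := key (fun B => -c B) fun B => abs_neg _
    simpa [Finset.sum_neg_distrib] using this
  have hSle : S ≤ S ^ (1 / q) := by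
    calc S = Φ (∑ B, c B • ψ B) := by
          rw [map_sum]
          exact Finset.sum_congr rfl fun B _ => by rw [map_smul, smul_eq_mul, ← hct B]
      _ ≤ ‖Φ‖ * ‖∑ B, c B • ψ B‖ := (le_abs_self _).trans (Φ.le_opNorm _)
      _ ≤ 1 * S ^ (1 / q) := by gcongr
      _ = S ^ (1 / q) := one_mul _
  have hS1 : S ≤ 1 := by
    by_contra! h
    have h2 : S ^ (1 / q) < S ^ (1 : ℝ) := by
      refine Real.rpow_lt_rpow_of_exponent_lt h ?_
      rw [one_div]
      exact inv_lt_one_of_one_lt₀ hpq.symm.lt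
    rw [Real.rpow_one] at h2
    linarith
  exact Real.rpow_le_one hS0 hS1 (by positivity)

theorem IsLpSpaceWith.exists_normalized {p lam : ℝ} (hp : 0 < p) {Y : Type*}
    [NormedAddCommGroup Y] [NormedSpace ℝ Y] (hY : IsLpSpaceWith p lam Y) (s : Finset Y) :
    ∃ (m : ℕ) (w : Y →ₗ[ℝ] (Fin m → ℝ)),
      ∀ y ∈ s, lpNorm p (w y) ≤ ‖y‖ ∧ ‖y‖ ≤ lam * lpNorm p (w y) := by
  obtain ⟨Y₀, hE, -, v, a, b, ha, hb, hab⟩ :=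
    hY (Submodule.span ℝ (s : Set Y)) (FiniteDimensional.span_finset ℝ s)
  obtain ⟨w, hw⟩ := LinearMap.exists_extend v.toLinearMap
  have hw' : ∀ y : Y₀, w y = v y := fun y => LinearMap.congr_fun hw y
  refine ⟨_, a⁻¹ • w, fun y hy => ?_⟩
  have hyY : y ∈ Y₀ := hE (Submodule.subset_span hy)
  rcases eq_or_ne y 0 with rfl | hy0
  · simp [lpNorm, hp.ne']
  have hny : 0 < ‖y‖ := norm_pos_iff.mpr hy0
  have h1 := ha ⟨y, hyY⟩
  have h2 := hb (v ⟨y, hyY⟩)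
  rw [v.symm_apply_apply, ← hw'] at h2
  rw [← hw'] at h1
  simp only [Submodule.coe_norm] at h1 h2
  have hL := lpNorm_nonneg p (w y)
  have hLpos : 0 < lpNorm p (w y) := hL.lt_of_ne fun h => by
    rw [← h, mul_zero] at h2; linarith
  have ha0 : 0 < a := by
    by_contra! h
    nlinarith
  rw [LinearMap.smul_apply, lpNorm_smul hp, abs_of_pos (inv_pos.mpr ha0)]
  refine ⟨by rwa [inv_mul_le_iff₀ ha0], h2.trans ?_⟩
  calc b * lpNorm p (w y) = (a * b) * (a⁻¹ * lpNorm p (w y)) := by field_simp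
    _ ≤ _ := by gcongr

/-- A local form of the embedding of an `L_{p,λ}`-space into an `L_p`-space: finitely many vectors
are almost normed by a contraction into some `ℓ_p^N` defined on the whole space. -/
theorem IsLpSpaceWith.exists_functionals {p lam : ℝ} (hp : 1 < p) (hlam : 0 ≤ lam) {Y : Type*}
    [NormedAddCommGroup Y] [NormedSpace ℝ Y] (hY : IsLpSpaceWith p lam Y) {n : ℕ} (y : Fin n → Y)
    {δ : ℝ} (hδ : 0 < δ) :
    ∃ (N : ℕ) (ψ : Fin N → Y →L[ℝ] ℝ), (∀ z, lpNorm p (fun B => ψ B z) ≤ ‖z‖) ∧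
      ∀ i, ‖y i‖ ≤ lam * (lpNorm p (fun B => ψ B (y i)) + δ) := by
  classical
  have hp0 : 0 < p := by linarith
  set K := (∑ j, ‖y j‖ ^ p) ^ (1 / p) with hK
  have hK0 : 0 ≤ K :=
    Real.rpow_nonneg (Finset.sum_nonneg fun _ _ => Real.rpow_nonneg (norm_nonneg _) _) _
  obtain ⟨N, hN⟩ := exists_uniform_contraction hp n (ε := δ / (K + 1)) (by positivity)
  have hloc : ∀ s : Finset Y, ∃ θ : Y →ₗ[ℝ] (Fin N → ℝ), (∀ z ∈ s, lpNorm p (θ z) ≤ ‖z‖) ∧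
      ∀ i, ‖y i‖ ≤ lam * (lpNorm p (θ (y i)) + δ) := fun s => by
    obtain ⟨m, w, hw⟩ := hY.exists_normalized hp0 (s ∪ Finset.univ.image y)
    have hwy : ∀ i, lpNorm p (w (y i)) ≤ ‖y i‖ ∧ ‖y i‖ ≤ lam * lpNorm p (w (y i)) :=
      fun i => hw _ (Finset.mem_union_right _ (Finset.mem_image_of_mem y (Finset.mem_univ i)))
    obtain ⟨Q, hQ, hQf⟩ := hN m fun i => w (y i)
    refine ⟨Q ∘ₗ w, fun z hz => (hQ _).trans (hw z (Finset.mem_union_left _ hz)).1, fun i => ?_⟩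
    refine (hwy i).2.trans (mul_le_mul_of_nonneg_left ((hQf i).trans ?_) hlam)
    have h1 : (∑ j, lpNorm p (w (y j)) ^ p) ^ (1 / p) ≤ K := by
      refine Real.rpow_le_rpow
        (Finset.sum_nonneg fun _ _ => Real.rpow_nonneg (lpNorm_nonneg p _) _)
        (Finset.sum_le_sum fun j _ => ?_) (by positivity)
      exact Real.rpow_le_rpow (lpNorm_nonneg p _) (hwy j).1 hp0.le
    have h2 : δ / (K + 1) * (∑ j, lpNorm p (w (y j)) ^ p) ^ (1 / p) ≤ δ := by
      calc _ ≤ δ / (K + 1) * (K + 1) := by gcongr; linarith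
        _ = δ := by field_simp
    rw [LinearMap.comp_apply]
    linarith
  choose θ hθ hθy using hloc
  set U : Ultrafilter (Finset Y) := Ultrafilter.of Filter.atTop
  have hmem : ∀ z : Y, ∀ᶠ s in (U : Filter (Finset Y)), z ∈ s := fun z =>
    Ultrafilter.of_le _ ((Filter.eventually_ge_atTop {z}).mono fun s hs =>
      hs (Finset.mem_singleton_self z))
  have habs : ∀ (v : Fin N → ℝ) B, |v B| ≤ lpNorm p v := fun v B => by
    rw [← Real.rpow_rpow_inv (abs_nonneg (v B)) hp0.ne', ← one_div]
    refine Real.rpow_le_rpow (Real.rpow_nonneg (abs_nonneg _) _) ?_ (by positivity)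
    exact Finset.single_le_sum (f := fun j => |v j| ^ p)
      (fun _ _ => Real.rpow_nonneg (abs_nonneg _) _) (Finset.mem_univ B)
  have hlim : ∀ B z, ∃ l, Filter.Tendsto (fun s => θ s z B) U (nhds l) := fun B z => by
    obtain ⟨l, -, hl⟩ := (isCompact_Icc (a := -‖z‖) (b := ‖z‖)).ultrafilter_le_nhds
      (U.map fun s => θ s z B) (Filter.le_principal_iff.mpr ((hmem z).mono fun s hs =>
        abs_le.mp ((habs _ B).trans (hθ s z hs))))
    exact ⟨l, hl⟩
  choose l hl using hlim
  have hlp : ∀ z, Filter.Tendsto (fun s => lpNorm p (θ s z)) U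
      (nhds (lpNorm p fun B => l B z)) := fun z => by
    unfold lpNorm
    refine Filter.Tendsto.rpow_const ?_ (Or.inr (by positivity))
    exact tendsto_finsetSum _ fun B _ => ((hl B z).abs).rpow_const (Or.inr hp0.le)
  have hbound : ∀ z, lpNorm p (fun B => l B z) ≤ ‖z‖ := fun z =>
    le_of_tendsto (hlp z) ((hmem z).mono fun s hs => hθ s z hs)
  refine ⟨N, fun B => LinearMap.mkContinuous
    { toFun := l B
      map_add' := fun z z' => tendsto_nhds_unique (hl B (z + z'))
        (((hl B z).add (hl B z')).congr fun s => by simp)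
      map_smul' := fun c z => tendsto_nhds_unique (hl B (c • z))
        (((hl B z).const_mul c).congr fun s => by simp) } 1 fun z => ?_, hbound, fun i => ?_⟩
  · rw [one_mul]
    exact (habs (fun B => l B z) B).trans (hbound z)
  · exact ge_of_tendsto (((hlp (y i)).add_const δ).const_mul lam)
      (Filter.Eventually.of_forall fun s => hθy s i)

theorem cube_average_norm_le_radAvg {F : Type*} [NormedAddCommGroup F] [NormedSpace ℝ F]
    {n : ℕ} (y : Fin n → F) :
    (2 ^ n : ℝ)⁻¹ * ∑ ε : Fin n → Bool, ‖∑ i, (if ε i then (1 : ℝ) else -1) • y i‖ ≤ radAvg y := by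
  refine Real.le_sqrt_of_sq_le ?_
  have h := sq_sum_le_card_mul_sum_sq (s := (Finset.univ : Finset (Fin n → Bool)))
    (f := fun ε => ‖∑ i, (if ε i then (1 : ℝ) else -1) • y i‖)
  simp only [Finset.card_univ, Fintype.card_fun, Fintype.card_bool, Fintype.card_fin] at h
  push_cast at h
  rw [mul_pow]
  calc _ ≤ ((2 ^ n : ℝ)⁻¹) ^ 2 * (2 ^ n *
        ∑ ε : Fin n → Bool, ‖∑ i, (if ε i then (1 : ℝ) else -1) • y i‖ ^ 2) := by gcongr
    _ = _ := by field_simp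

theorem bddAbove_sum_abs_apply {X : Type*} [NormedAddCommGroup X] [NormedSpace ℝ X] {n : ℕ}
    (x : Fin n → X) :
    BddAbove (Set.range fun φ : {φ : X →L[ℝ] ℝ // ‖φ‖ ≤ 1} => ∑ i, |φ.1 (x i)|) := by
  refine ⟨∑ i, ‖x i‖, ?_⟩
  rintro _ ⟨φ, rfl⟩
  exact Finset.sum_le_sum fun i _ => φ.1.le_of_opNorm_le φ.2 (x i) |>.trans (one_mul _).le

theorem sum_abs_apply_le {X : Type*} [NormedAddCommGroup X] [NormedSpace ℝ X] {n : ℕ}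
    (x : Fin n → X) (g : X →L[ℝ] ℝ) :
    ∑ i, |g (x i)| ≤ ‖g‖ * ⨆ φ : {φ : X →L[ℝ] ℝ // ‖φ‖ ≤ 1}, ∑ i, |φ.1 (x i)| := by
  rcases eq_or_ne g 0 with rfl | hg
  · simp
  have hg0 : 0 < ‖g‖ := norm_pos_iff.mpr hg
  have h := le_ciSup (bddAbove_sum_abs_apply x)
    ⟨‖g‖⁻¹ • g, by rw [norm_smul, norm_inv, norm_norm, inv_mul_cancel₀ hg0.ne']⟩
  simp only [smul_apply, smul_eq_mul, abs_mul, ← Finset.mul_sum, abs_inv,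
    abs_norm] at h
  rwa [inv_mul_le_iff₀ hg0] at h

theorem sum_norm_le_of_almostSumming_bound {X Y : Type*}
    [NormedAddCommGroup X] [NormedSpace ℝ X] [NormedAddCommGroup Y] [NormedSpace ℝ Y]
    {p lam C : ℝ} (hp : 2 ≤ p) (hlam : 0 ≤ lam) (hY : IsLpSpaceWith p lam Y) (T : X →L[ℝ] Y)
    (hC0 : 0 ≤ C) (hC : ∀ (n : ℕ) (ψ : Fin n → Y →L[ℝ] ℝ),
      radAvg (fun i => (ψ i).comp T) ≤ C * weakNorm p ψ)
    {n : ℕ} (x : Fin n → X) :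
    ∑ i, ‖T (x i)‖ ≤ Real.sqrt 2 * lam * C *
      ⨆ φ : {φ : X →L[ℝ] ℝ // ‖φ‖ ≤ 1}, ∑ i, |φ.1 (x i)| := by
  set W := ⨆ φ : {φ : X →L[ℝ] ℝ // ‖φ‖ ≤ 1}, ∑ i, |φ.1 (x i)|
  have hW0 : 0 ≤ W := Real.iSup_nonneg fun φ => Finset.sum_nonneg fun _ _ => abs_nonneg _
  have hδ : ∀ δ : ℝ, 0 < δ → ∑ i, ‖T (x i)‖ ≤ Real.sqrt 2 * lam * C * W + lam * n * δ := by
    intro δ hδ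
    obtain ⟨N, ψ, hψ, hψx⟩ :=
      hY.exists_functionals (by linarith) hlam (fun i => T (x i)) hδ
    set g : (Fin N → Bool) → X →L[ℝ] ℝ :=
      fun ε => ∑ B, (if ε B then (1 : ℝ) else -1) • (ψ B).comp T with hg
    have hgx : ∀ ε z, g ε z = ∑ B, (if ε B then (1 : ℝ) else -1) * ψ B (T z) := fun ε z => by
      simp only [hg, sum_apply, smul_apply, ContinuousLinearMap.comp_apply, smul_eq_mul]
    have h1 : ∀ i, ‖T (x i)‖ ≤
        lam * (Real.sqrt 2 * ((2 ^ N : ℝ)⁻¹ * ∑ ε, |g ε (x i)|) + δ) := fun i => by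
      refine (hψx i).trans (mul_le_mul_of_nonneg_left (add_le_add ?_ le_rfl) hlam)
      refine (lpNorm_le_sqrt hp _).trans ?_
      simpa only [hgx] using khintchine_one fun B => ψ B (T (x i))
    have hrad : (2 ^ N : ℝ)⁻¹ * ∑ ε, ‖g ε‖ ≤ C :=
      calc _ ≤ radAvg (fun B => (ψ B).comp T) := cube_average_norm_le_radAvg _
        _ ≤ C * weakNorm p ψ := hC N ψ
        _ ≤ C * 1 := mul_le_mul_of_nonneg_left
          (weakNorm_le_of_forall_lpNorm_le (by linarith) ψ hψ) hC0
        _ = C := mul_one C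
    have hsum : ∑ i, ∑ ε, |g ε (x i)| ≤ (∑ ε, ‖g ε‖) * W := by
      rw [Finset.sum_comm, Finset.sum_mul]
      exact Finset.sum_le_sum fun ε _ => sum_abs_apply_le x (g ε)
    calc ∑ i, ‖T (x i)‖
        ≤ ∑ i, lam * (Real.sqrt 2 * ((2 ^ N : ℝ)⁻¹ * ∑ ε, |g ε (x i)|) + δ) :=
          Finset.sum_le_sum fun i _ => h1 i
      _ = lam * Real.sqrt 2 * (2 ^ N : ℝ)⁻¹ * (∑ i, ∑ ε, |g ε (x i)|) + lam * n * δ := by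
          simp only [← Finset.mul_sum, Finset.sum_add_distrib, Finset.sum_const, Finset.card_univ,
            Fintype.card_fin, nsmul_eq_mul]
          ring
      _ ≤ lam * Real.sqrt 2 * (2 ^ N : ℝ)⁻¹ * ((∑ ε, ‖g ε‖) * W) + lam * n * δ := by gcongr
      _ = lam * Real.sqrt 2 * W * ((2 ^ N : ℝ)⁻¹ * ∑ ε, ‖g ε‖) + lam * n * δ := by ring
      _ ≤ lam * Real.sqrt 2 * W * C + lam * n * δ := by gcongr
      _ = _ := by ring
  refine le_of_forall_pos_le_add fun η hη => ?_
  refine (hδ (η / (lam * n + 1)) (by positivity)).trans (add_le_add le_rfl ?_)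
  rw [mul_div_assoc', div_le_iff₀ (by positivity)]
  nlinarith

/-- Quantitative Kwapień-type theorem: if `X` is a real Banach space, `2 ≤ p < ∞`, `λ > 1`,
`Y` is a real Banach `L_{p,λ}`-space, and `T : X → Y` is a bounded linear operator whose
adjoint `T* : Y* → X*` is almost `p`-summing, then for all finite families `xᵢ ∈ X`,
`∑ ‖T(xᵢ)‖ ≤ √2 ⬝ λ ⬝ π_{al.s.p}(T*) ⬝ sup_{‖φ‖ ≤ 1} ∑ |φ(xᵢ)|`. -/
theorem kwapien_Lp_quantitative {X Y : Type*}
    [NormedAddCommGroup X] [NormedSpace ℝ X] [CompleteSpace X]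
    [NormedAddCommGroup Y] [NormedSpace ℝ Y] [CompleteSpace Y]
    (p lam : ℝ) (hp : 2 ≤ p) (hlam : 1 < lam) (hY : IsLpSpaceWith p lam Y)
    (T : X →L[ℝ] Y)
    (hadj : AlmostSumming p (fun ψ : Y →L[ℝ] ℝ => ψ.comp T)) :
    ∀ (n : ℕ) (x : Fin n → X),
      ∑ i, ‖T (x i)‖ ≤
        Real.sqrt 2 * lam * almostSummingConst p (fun ψ : Y →L[ℝ] ℝ => ψ.comp T) *
          ⨆ φ : {φ : X →L[ℝ] ℝ // ‖φ‖ ≤ 1}, ∑ i, |φ.1 (x i)| := by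
  intro n x
  set W := ⨆ φ : {φ : X →L[ℝ] ℝ // ‖φ‖ ≤ 1}, ∑ i, |φ.1 (x i)|
  have hW0 : 0 ≤ W := Real.iSup_nonneg fun φ => Finset.sum_nonneg fun _ _ => abs_nonneg _
  have hbound : ∀ C : ℝ, 0 ≤ C → (∀ (n : ℕ) (ψ : Fin n → Y →L[ℝ] ℝ),
      radAvg (fun i => (ψ i).comp T) ≤ C * weakNorm p ψ) →
      ∑ i, ‖T (x i)‖ ≤ Real.sqrt 2 * lam * C * W := fun C hC0 hC =>
    sum_norm_le_of_almostSumming_bound hp (by linarith) hY T hC0 hC x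
  rcases hW0.eq_or_lt with h0 | h0
  · obtain ⟨C, hC0, hC⟩ := hadj
    have := hbound C hC0 hC
    rw [← h0, mul_zero] at this ⊢
    exact this
  · have hc : 0 < Real.sqrt 2 * lam * W := by positivity
    have hle : (∑ i, ‖T (x i)‖) / (Real.sqrt 2 * lam * W) ≤
        almostSummingConst p (fun ψ : Y →L[ℝ] ℝ => ψ.comp T) := by
      refine le_csInf hadj fun C hC => ?_
      rw [div_le_iff₀ hc]
      linarith [hbound C hC.1 hC.2]
    rw [div_le_iff₀ hc] at hle
    linarith
end
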